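/- arXiv:0801.2088 — 3 statements merged into one kernel-verified Lean document; each statement's English description precedes it below -/
import Mathlib

section
/- Let w = w_0…w_{l-1} be a nonempty word over A. Then there exist an index 0 ≤ i < l and a prefix q of σ(w_i) such that γ(σ(w_0…w_{i-1})) + γ(q) = min{ γ(u) : u a prefix of σ(w) }, and i is the best occurrence of the letter w_i in w, i.e. γ(w_0…w_i) ≤ γ(w_0…w_j) for every 0 ≤ j < l with w_j = w_i. -/
open scoped BigOperators
open IntermediateField Filter

/-- A substitution applied to a word (concatenation of the images of its letters). -/
def substW {A : Type*} (σ : A → List A) (w : List A) : List A := (w.map σ).flatten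

/-- `σ^n(a)`: the `n`-th iterate of the substitution on the letter `a`. -/
def substIter {A : Type*} (σ : A → List A) (n : ℕ) (a : A) : List A := (substW σ)^[n] [a]

/-- `γ(w)`: the sum of `γ` over the letters of the word `w` (with `γ(ε) = 0`). -/
def gammaW {A : Type*} (γ : A → ℝ) (w : List A) : ℝ := (w.map γ).sum

/-- The finite window `x_m x_{m+1} … x_{m+len-1}` of a two-sided sequence `x`. -/
def wordOf {A : Type*} (x : ℤ → A) (m : ℤ) (len : ℕ) : List A :=
  (List.range len).map (fun k => x (m + k))

/-- Membership in the subshift `X_σ`: every finite subword of `x` is a subword of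
some `σ^N(a)`. -/
def InXsigma {A : Type*} (σ : A → List A) (x : ℤ → A) : Prop :=
  ∀ (m : ℤ) (len : ℕ), ∃ (N : ℕ) (a : A), (wordOf x m len) <:+: substIter σ N a

/-- `γ_n(x)`: equals `γ(x_0 … x_{n-1})` for `n > 0`, `0` for `n = 0`, and
`γ(x_n … x_{-1})` for `n < 0`. -/
def gammaZ {A : Type*} (γ : A → ℝ) (x : ℤ → A) (n : ℤ) : ℝ :=
  if 0 ≤ n then gammaW γ (wordOf x 0 n.toNat) else gammaW γ (wordOf x n (-n).toNat)

/-- A minimal point: a point of `X_σ` with `γ_n(x) ≥ 0` for all `n ∈ ℤ`. -/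
def IsMinimalPt {A : Type*} (σ : A → List A) (γ : A → ℝ) (x : ℤ → A) : Prop :=
  InXsigma σ x ∧ ∀ n : ℤ, 0 ≤ gammaZ γ x n

/-- Primitivity of a substitution: some power of `σ` applied to any letter
contains every letter. -/
def Primitive {A : Type*} (σ : A → List A) : Prop :=
  ∃ N : ℕ, 0 < N ∧ ∀ a b : A, b ∈ substIter σ N a

theorem gammaW_append {A : Type*} (γ : A → ℝ) (u v : List A) :
    gammaW γ (u ++ v) = gammaW γ u + gammaW γ v := by
  simp [gammaW]

theorem substW_append {A : Type*} (σ : A → List A) (u v : List A) :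
    substW σ (u ++ v) = substW σ u ++ substW σ v := by
  simp [substW]

theorem substW_cons {A : Type*} (σ : A → List A) (a : A) (w : List A) :
    substW σ (a :: w) = σ a ++ substW σ w := by
  simp [substW]

/-- `γ` is multiplied by `θ` under `σ` when it is an eigenvector of the incidence matrix. -/
theorem gammaW_substW {A : Type*} [Fintype A] [DecidableEq A] (σ : A → List A)
    (γ : A → ℝ) (θ : ℝ)
    (heig : ∀ a, ∑ b : A, ((σ a).count b : ℝ) * γ b = θ * γ a) (w : List A) :
    gammaW γ (substW σ w) = θ * gammaW γ w := by
  induction w with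
  | nil => simp [gammaW, substW]
  | cons a w ih =>
    have h : gammaW γ (σ a) = θ * γ a := by
      rw [← heig, gammaW, Finset.sum_list_map_count]
      simp only [nsmul_eq_mul]
      refine Finset.sum_subset (Finset.subset_univ _) fun b _ hb => ?_
      rw [List.count_eq_zero_of_not_mem (by simpa using hb)]
      simp
    rw [substW_cons, gammaW_append, ih, h]
    simp [gammaW, mul_add]

/-- Every prefix of `σ(w)` ends inside the image of some letter of `w`. -/
theorem exists_eq_substW_take_append {A : Type*} (σ : A → List A) (w : List A) (hw : w ≠ [])
    (u : List A) (hu : u <+: substW σ w) :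
    ∃ i : Fin w.length, ∃ q : List A, q <+: σ (w.get i) ∧ u = substW σ (w.take i) ++ q := by
  induction w generalizing u with
  | nil => exact absurd rfl hw
  | cons a w ih =>
    rw [substW_cons] at hu
    rcases List.prefix_or_prefix_of_prefix hu (List.prefix_append (σ a) _) with hu' | ⟨v, rfl⟩
    · exact ⟨⟨0, by simp⟩, u, by simpa using hu', by simp [substW]⟩
    · have hv := (List.prefix_append_right_inj _).1 hu
      rcases eq_or_ne w [] with rfl | hne
      · have hv' : v = [] := by simpa [substW] using hv
        exact ⟨⟨0, by simp⟩, σ a, by simp, by simp [substW, hv']⟩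
      · obtain ⟨i, q, hq, rfl⟩ := ih hne v hv
        exact ⟨i.succ, q, by simpa using hq, by simp [substW_cons]⟩

/-- Appending to `σ(w_0 … w_{i-1})` a prefix of `σ(w_i)` gives a prefix of `σ(w)`. -/
theorem substW_take_append_prefix {A : Type*} (σ : A → List A) (w : List A) (i : Fin w.length)
    (q : List A) (hq : q <+: σ (w.get i)) : substW σ (w.take i) ++ q <+: substW σ w := by
  have h : w = w.take i ++ w.get i :: w.drop (i + 1) := by simp
  conv_rhs => rw [h, substW_append, substW_cons]
  exact (List.prefix_append_right_inj _).2 (hq.trans (List.prefix_append _ _))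

/-- Lemma 3.4 of the paper: the minimum of `γ` over prefixes of
`σ(w)` is attained inside `σ(w_i)` where `i` is the best occurrence of the letter
`w_i` in `w`. -/
theorem statement_6 {A : Type*} [Fintype A] [DecidableEq A]
    (σ : A → List A) (hσ : ∀ a, σ a ≠ [])
    (hprim : Primitive σ)
    (hMpos : ∀ a b : A, 0 < (σ a).count b)
    (θ₁ θ₂ : ℝ) (hθ₁alg : IsAlgebraic ℚ θ₁)
    (hθ₂1 : 1 < θ₂) (hθ₂θ₁ : θ₂ < θ₁)
    (hconj : Polynomial.aeval θ₂ (minpoly ℚ θ₁) = 0)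
    (lam : A → ℚ⟮θ₁⟯) (hlampos : ∀ a, (0:ℝ) < (lam a : ℝ))
    (heig1 : ∀ a, ∑ b : A, ((σ a).count b : ℝ) * (lam b : ℝ) = θ₁ * (lam a : ℝ))
    (η : ℚ⟮θ₁⟯ →ₐ[ℚ] ℝ) (hη : η (AdjoinSimple.gen ℚ θ₁) = θ₂)
    (γ : A → ℝ) (hγ : ∀ a, γ a = η (lam a))
    (heig2 : ∀ a, ∑ b : A, ((σ a).count b : ℝ) * γ b = θ₂ * γ a)
    (w : List A) (hw : w ≠ []) :
    ∃ i : Fin w.length, ∃ q : List A, q <+: σ (w.get i) ∧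
      (∀ u : List A, u <+: substW σ w →
        gammaW γ (substW σ (w.take (i : ℕ))) + gammaW γ q ≤ gammaW γ u) ∧
      (∀ j : Fin w.length, w.get j = w.get i →
        gammaW γ (w.take ((i : ℕ) + 1)) ≤ gammaW γ (w.take ((j : ℕ) + 1))) := by
  obtain ⟨u, hu, hmin⟩ := (substW σ w).inits.toFinset.exists_min_image (gammaW γ)
    ⟨[], by simp⟩
  simp only [List.mem_toFinset, List.mem_inits] at hu hmin
  obtain ⟨i, q, hq, rfl⟩ := exists_eq_substW_take_append σ w hw u hu
  refine ⟨i, q, hq, fun u hu => ?_, fun j hj => ?_⟩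
  · rw [← gammaW_append]
    exact hmin u hu
  · have h := hmin _ (substW_take_append_prefix σ w j q (hj ▸ hq))
    rw [gammaW_append, gammaW_append, gammaW_substW σ γ θ₂ heig2,
      gammaW_substW σ γ θ₂ heig2] at h
    have h' : gammaW γ (w.take i) ≤ gammaW γ (w.take j) :=
      le_of_mul_le_mul_left (by linarith) (by linarith : 0 < θ₂)
    rw [List.take_succ_eq_append_getElem i.isLt, List.take_succ_eq_append_getElem j.isLt,
      gammaW_append, gammaW_append]
    simp only [List.get_eq_getElem] at hj
    rw [hj]
    linarith
end

section
/- For every a ∈ A there exists an ultimately periodic sequence x = (p_i,c_i,s_i)_{i∈ℕ} ∈ 𝒮 with c_0 = a and v(a; x) = v(a); ultimately periodic means there exist integers 0 ≤ q < p such that (p_{i+p-q}, c_{i+p-q}, s_{i+p-q}) = (p_i, c_i, s_i) for all i ≥ q. -/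
open scoped BigOperators
open IntermediateField Filter

/-- The set `𝒮` of admissible decomposition sequences `(p_i, c_i, s_i)_{i ∈ ℕ}`:
`σ(c_i) = p_{i+1} c_{i+1} s_{i+1}` for all `i ≥ 0`. -/
def SeqS {A : Type*} (σ : A → List A) (x : ℕ → List A × A × List A) : Prop :=
  ∀ i : ℕ, σ ((x i).2.1) = (x (i+1)).1 ++ (x (i+1)).2.1 :: (x (i+1)).2.2

/-- `v(a ; x) = Σ_{i ≥ 1} θ₂^{-i} γ(p_i)` (with `a = c_0^x`). -/
noncomputable def vOf {A : Type*} (θ₂ : ℝ) (γ : A → ℝ) (x : ℕ → List A × A × List A) : ℝ :=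
  ∑' i : ℕ, θ₂ ^ (-(i : ℤ) - 1) * gammaW γ ((x (i+1)).1)

/-- `v(a) = inf { v(a ; x) : x ∈ 𝒮, c_0^x = a }`. -/
noncomputable def vMin {A : Type*} (σ : A → List A) (θ₂ : ℝ) (γ : A → ℝ) (a : A) : ℝ :=
  sInf { v : ℝ | ∃ x : ℕ → List A × A × List A, SeqS σ x ∧ (x 0).2.1 = a ∧ v = vOf θ₂ γ x }

/-- The ways `w = p ++ c :: s` of singling out one letter of the word `w`. -/
def splittings {A : Type*} (w : List A) : Set (List A × A × List A) :=
  {t | w = t.1 ++ t.2.1 :: t.2.2}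

theorem splittings_finite {A : Type*} (w : List A) : (splittings w).Finite := by
  refine (Set.finite_range
    (fun k : Fin w.length => (w.take k, w[k], w.drop (k + 1)))).subset ?_
  rintro ⟨p, c, s⟩ h
  change w = p ++ c :: s at h
  subst h
  exact ⟨⟨p.length, by simp⟩, by simp⟩

theorem splittings_nonempty {A : Type*} {w : List A} (hw : w ≠ []) :
    (splittings w).Nonempty := by
  obtain ⟨c, s, rfl⟩ := List.exists_cons_of_ne_nil hw
  exact ⟨([], c, s), rfl⟩

theorem exists_abs_gammaW_le {A : Type*} [Finite A] (σ : A → List A) (γ : A → ℝ) :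
    ∃ K : ℝ, ∀ a, ∀ t ∈ splittings (σ a), |gammaW γ t.1| ≤ K := by
  have hfin : (⋃ a, (fun t : List A × A × List A => |gammaW γ t.1|) ''
      splittings (σ a)).Finite :=
    Set.finite_iUnion fun a => (splittings_finite _).image _
  obtain ⟨K, hK⟩ := hfin.bddAbove
  exact ⟨K, fun a t ht => hK (Set.mem_iUnion.2 ⟨a, t, ht, rfl⟩)⟩

theorem abs_vOf_term_le {A : Type*} {θ₂ : ℝ} (hθ : 1 < θ₂) {γ : A → ℝ} {K : ℝ}
    {x : ℕ → List A × A × List A} (hK : ∀ i, |gammaW γ (x (i + 1)).1| ≤ K) (i : ℕ) :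
    |θ₂ ^ (-(i : ℤ) - 1) * gammaW γ (x (i + 1)).1| ≤ θ₂⁻¹ ^ i * (θ₂⁻¹ * K) := by
  have h0 : 0 < θ₂ := by linarith
  have he : θ₂ ^ (-(i : ℤ) - 1) = θ₂⁻¹ ^ i * θ₂⁻¹ := by
    rw [zpow_sub₀ h0.ne', zpow_neg, zpow_natCast, zpow_one, inv_pow, div_eq_mul_inv]
  rw [he, abs_mul, abs_of_pos (by positivity), mul_assoc]
  gcongr
  exact hK i

theorem summable_geometric_bound {θ₂ : ℝ} (hθ : 1 < θ₂) (K : ℝ) :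
    Summable fun i : ℕ => θ₂⁻¹ ^ i * (θ₂⁻¹ * K) :=
  (summable_geometric_of_lt_one (by positivity) (inv_lt_one_of_one_lt₀ hθ)).mul_right _

theorem summable_vOf {A : Type*} {θ₂ : ℝ} (hθ : 1 < θ₂) {γ : A → ℝ} {K : ℝ}
    {x : ℕ → List A × A × List A} (hK : ∀ i, |gammaW γ (x (i + 1)).1| ≤ K) :
    Summable fun i : ℕ => θ₂ ^ (-(i : ℤ) - 1) * gammaW γ (x (i + 1)).1 :=
  Summable.of_norm_bounded (summable_geometric_bound hθ K) (abs_vOf_term_le hθ hK)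

theorem abs_vOf_le {A : Type*} {θ₂ : ℝ} (hθ : 1 < θ₂) {γ : A → ℝ} {K : ℝ}
    {x : ℕ → List A × A × List A} (hK : ∀ i, |gammaW γ (x (i + 1)).1| ≤ K) :
    |vOf θ₂ γ x| ≤ ∑' i : ℕ, θ₂⁻¹ ^ i * (θ₂⁻¹ * K) :=
  (Real.norm_eq_abs _).symm.trans_le <|
    tsum_of_norm_bounded (summable_geometric_bound hθ K).hasSum (abs_vOf_term_le hθ hK)

theorem vOf_eq_head_add_tail {A : Type*} {θ₂ : ℝ} (hθ : 1 < θ₂) {γ : A → ℝ} {K : ℝ}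
    {x : ℕ → List A × A × List A} (hK : ∀ i, |gammaW γ (x (i + 1)).1| ≤ K) :
    vOf θ₂ γ x = θ₂⁻¹ * (gammaW γ (x 1).1 + vOf θ₂ γ fun i => x (i + 1)) := by
  have h0 : θ₂ ≠ 0 := by linarith
  unfold vOf
  rw [(summable_vOf hθ hK).tsum_eq_zero_add, mul_add, ← tsum_mul_left]
  congr 1
  · simp
  · refine tsum_congr fun i => ?_
    rw [← mul_assoc, ← zpow_neg_one, ← zpow_add₀ h0]
    push_cast
    ring_nf

/-- The orbit of a letter under a choice `f` of one splitting of each `σ a`. -/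
def splittingOrbit {A : Type*} (f : A → List A × A × List A) (a : A) :
    ℕ → List A × A × List A
  | 0 => ([], a, [])
  | n + 1 => f (splittingOrbit f a n).2.1

theorem splittingOrbit_succ_eq {A : Type*} (f : A → List A × A × List A) (a : A) (n : ℕ) :
    splittingOrbit f a (n + 1) = f ((fun b => (f b).2.1)^[n] a) := by
  have h : ∀ n, (splittingOrbit f a n).2.1 = (fun b => (f b).2.1)^[n] a := by
    intro n
    induction n with
    | zero => rfl
    | succ n ih => rw [Function.iterate_succ_apply', ← ih]; rfl
  rw [← h]; rfl

theorem seqS_splittingOrbit {A : Type*} {σ : A → List A} {f : A → List A × A × List A}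
    (hf : ∀ a, f a ∈ splittings (σ a)) (a : A) : SeqS σ (splittingOrbit f a) :=
  fun _ => hf _

theorem SeqS.tail {A : Type*} {σ : A → List A} {x : ℕ → List A × A × List A}
    (hx : SeqS σ x) : SeqS σ fun i => x (i + 1) :=
  fun i => hx (i + 1)

theorem splittingOrbit_eventually_periodic {A : Type*} [Finite A]
    (f : A → List A × A × List A) (a : A) :
    ∃ q p : ℕ, q < p ∧
      ∀ i, q ≤ i → splittingOrbit f a (i + (p - q)) = splittingOrbit f a i := by
  set g : A → A := fun b => (f b).2.1 with hg
  obtain ⟨m, n, hne, hmn⟩ := Finite.exists_ne_map_eq_of_infinite fun k : ℕ => g^[k] a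
  wlog hlt : m < n generalizing m n
  · exact this n m hne.symm hmn.symm (by omega)
  refine ⟨m + 1, n + 1, by omega, fun i hi => ?_⟩
  obtain ⟨j, rfl⟩ := Nat.exists_eq_add_of_le' hi
  rw [show j + (m + 1) + (n + 1 - (m + 1)) = (j + n) + 1 by omega, ← add_assoc,
    splittingOrbit_succ_eq, splittingOrbit_succ_eq, ← hg, Function.iterate_add_apply,
    Function.iterate_add_apply, hmn]

theorem vMin_le_vOf {A : Type*} {θ₂ : ℝ} (hθ : 1 < θ₂) {σ : A → List A} {γ : A → ℝ} {K : ℝ}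
    (hK : ∀ a, ∀ t ∈ splittings (σ a), |gammaW γ t.1| ≤ K)
    {x : ℕ → List A × A × List A} (hx : SeqS σ x) :
    vMin σ θ₂ γ (x 0).2.1 ≤ vOf θ₂ γ x := by
  refine csInf_le ⟨-∑' i : ℕ, θ₂⁻¹ ^ i * (θ₂⁻¹ * K), ?_⟩ ⟨x, hx, rfl, rfl⟩
  rintro _ ⟨y, hy, -, rfl⟩
  exact neg_le_of_abs_le (abs_vOf_le hθ fun i => hK _ _ (hy i))

/-- Following, at each letter, a splitting that satisfies the Bellman inequality for `vMin`
realizes the infimum. -/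
theorem vOf_splittingOrbit_le_vMin {A : Type*} [Finite A] {θ₂ : ℝ} (hθ : 1 < θ₂) {σ : A → List A}
    {γ : A → ℝ} {f : A → List A × A × List A} (hf : ∀ a, f a ∈ splittings (σ a))
    (hv : ∀ a, θ₂⁻¹ * (gammaW γ (f a).1 + vMin σ θ₂ γ (f a).2.1) ≤ vMin σ θ₂ γ a) (a : A) :
    vOf θ₂ γ (splittingOrbit f a) ≤ vMin σ θ₂ γ a := by
  obtain ⟨K, hK⟩ := exists_abs_gammaW_le σ γ
  have h0 : 0 < θ₂ := by linarith
  have hx := seqS_splittingOrbit hf a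
  set x := splittingOrbit f a with hxdef
  set V := vMin σ θ₂ γ with hV
  have key : ∀ n, ∑ i ∈ Finset.range n, θ₂ ^ (-(i : ℤ) - 1) * gammaW γ (x (i + 1)).1
      + θ₂⁻¹ ^ n * V (x n).2.1 ≤ V a := by
    intro n
    induction n with
    | zero => simp [hxdef, splittingOrbit]
    | succ n ih =>
      refine le_trans ?_ ih
      have he : θ₂ ^ (-(n : ℤ) - 1) = θ₂⁻¹ ^ n * θ₂⁻¹ := by
        rw [zpow_sub₀ h0.ne', zpow_neg, zpow_natCast, zpow_one, inv_pow, div_eq_mul_inv]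
      have h1 : θ₂⁻¹ * (gammaW γ (x (n + 1)).1 + V (x (n + 1)).2.1) ≤ V (x n).2.1 :=
        hv (x n).2.1
      have h2 := mul_le_mul_of_nonneg_left h1 (by positivity : 0 ≤ θ₂⁻¹ ^ n)
      rw [Finset.sum_range_succ, he, pow_succ]
      linarith
  have hlim := (summable_vOf hθ fun i => hK _ _ (hx i)).hasSum.tendsto_sum_nat
  obtain ⟨C, hC⟩ := (Set.finite_range fun b => |V b|).bddAbove
  have hpow := tendsto_pow_atTop_nhds_zero_of_lt_one (inv_nonneg.2 h0.le)
    (inv_lt_one_of_one_lt₀ hθ)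
  have hrem : Tendsto (fun n => θ₂⁻¹ ^ n * V (x n).2.1) atTop (nhds 0) :=
    squeeze_zero_norm (a := fun n => θ₂⁻¹ ^ n * C) (fun n => by
      rw [Real.norm_eq_abs, abs_mul, abs_of_pos (by positivity : 0 < θ₂⁻¹ ^ n)]
      exact mul_le_mul_of_nonneg_left (hC ⟨_, rfl⟩) (by positivity))
      (by simpa only [zero_mul] using hpow.mul_const C)
  have h := le_of_tendsto' (hlim.add hrem) key
  simpa [vOf] using h

theorem exists_splitting_le_vMin {A : Type*} [Finite A] {θ₂ : ℝ} (hθ : 1 < θ₂) {σ : A → List A}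
    (hσ : ∀ a, σ a ≠ []) (γ : A → ℝ) (a : A) :
    ∃ t ∈ splittings (σ a),
      θ₂⁻¹ * (gammaW γ t.1 + vMin σ θ₂ γ t.2.1) ≤ vMin σ θ₂ γ a := by
  obtain ⟨K, hK⟩ := exists_abs_gammaW_le σ γ
  have h0 : 0 < θ₂ := by linarith
  obtain ⟨t, ht, hmin⟩ := Set.exists_min_image (splittings (σ a))
    (fun t => θ₂⁻¹ * (gammaW γ t.1 + vMin σ θ₂ γ t.2.1)) (splittings_finite _)
    (splittings_nonempty (hσ a))
  choose f hf using fun b => splittings_nonempty (hσ b)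
  refine ⟨t, ht, le_csInf ⟨_, splittingOrbit f a, seqS_splittingOrbit hf a, rfl, rfl⟩ ?_⟩
  rintro _ ⟨x, hx, rfl, rfl⟩
  refine (hmin (x 1) (hx 0)).trans ?_
  rw [vOf_eq_head_add_tail hθ fun i => hK _ _ (hx i)]
  gcongr
  exact vMin_le_vOf hθ hK hx.tail

/-- Lemma 3.9 of the paper: for every `a ∈ A` there is an
ultimately periodic `x ∈ 𝒮` with `c_0^x = a` and `v(a ; x) = v(a)`. -/
theorem statement_11 {A : Type*} [Fintype A] [DecidableEq A]
    (σ : A → List A) (hσ : ∀ a, σ a ≠ [])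
    (hprim : Primitive σ)
    (hMpos : ∀ a b : A, 0 < (σ a).count b)
    (θ₁ θ₂ : ℝ) (hθ₁alg : IsAlgebraic ℚ θ₁)
    (hθ₂1 : 1 < θ₂) (hθ₂θ₁ : θ₂ < θ₁)
    (hconj : Polynomial.aeval θ₂ (minpoly ℚ θ₁) = 0)
    (lam : A → ℚ⟮θ₁⟯) (hlampos : ∀ a, (0:ℝ) < (lam a : ℝ))
    (heig1 : ∀ a, ∑ b : A, ((σ a).count b : ℝ) * (lam b : ℝ) = θ₁ * (lam a : ℝ))
    (η : ℚ⟮θ₁⟯ →ₐ[ℚ] ℝ) (hη : η (AdjoinSimple.gen ℚ θ₁) = θ₂)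
    (γ : A → ℝ) (hγ : ∀ a, γ a = η (lam a))
    (heig2 : ∀ a, ∑ b : A, ((σ a).count b : ℝ) * γ b = θ₂ * γ a)
    (a : A) :
    ∃ x : ℕ → List A × A × List A, SeqS σ x ∧ (x 0).2.1 = a ∧
      vOf θ₂ γ x = vMin σ θ₂ γ a ∧
      ∃ q p : ℕ, q < p ∧ ∀ i : ℕ, q ≤ i → x (i + (p - q)) = x i := by
  choose f hf hv using exists_splitting_le_vMin hθ₂1 hσ γ
  obtain ⟨K, hK⟩ := exists_abs_gammaW_le σ γ
  have hx := seqS_splittingOrbit hf a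
  exact ⟨splittingOrbit f a, hx, rfl,
    (vOf_splittingOrbit_le_vMin hθ₂1 hf hv a).antisymm (vMin_le_vOf hθ₂1 hK hx),
    splittingOrbit_eventually_periodic f a⟩
end

section
/- Let y = (p_i^y,c_i^y,s_i^y)_{i∈ℕ} ∈ 𝒮 have the continuation property: v(c_j^y; T^j y) = v(c_j^y) for all j ≥ 0. Let i ≥ 1 and let z ∈ 𝒮 satisfy c_0^z = c_i^y and v(c_i^y; z) = v(c_i^y). Then the spliced sequence w defined by w_j = y_j for 0 ≤ j ≤ i and w_{i+j} = z_j for j ≥ 1 belongs to 𝒮 and also has the continuation property. -/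
open scoped BigOperators
open IntermediateField Filter

/-- The spliced sequence: `w_j = y_j` for `0 ≤ j ≤ i` and `w_{i+j} = z_j` for `j ≥ 1`. -/
def spliceW {A : Type*} (y z : ℕ → List A × A × List A) (i : ℕ) :
    ℕ → List A × A × List A :=
  fun j => if j ≤ i then y j else z (j - i)

theorem SeqS.shift {A : Type*} {σ : A → List A} {x : ℕ → List A × A × List A}
    (hx : SeqS σ x) (j : ℕ) : SeqS σ (fun k => x (k + j)) := by
  intro k
  have := hx (k + j)
  rwa [show k + j + 1 = k + 1 + j by omega] at this

theorem SeqS.splice {A : Type*} {σ : A → List A} {y z : ℕ → List A × A × List A}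
    (hy : SeqS σ y) (hz : SeqS σ z) {i : ℕ} (h0 : (z 0).2.1 = (y i).2.1) :
    SeqS σ (spliceW y z i) := by
  intro k
  rcases lt_trichotomy k i with h | rfl | h
  · simpa [spliceW, h.le, Nat.succ_le_of_lt h] using hy k
  · simpa [spliceW, h0] using hz 0
  · have := hz (k - i)
    rw [show k - i + 1 = k + 1 - i by omega] at this
    simpa [spliceW, not_le.2 h, not_le.2 (Nat.lt_succ_of_lt h)] using this

theorem vOf_congr {A : Type*} (θ : ℝ) (γ : A → ℝ) {x x' : ℕ → List A × A × List A}
    (h : ∀ k, x (k + 1) = x' (k + 1)) : vOf θ γ x = vOf θ γ x' := by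
  simp only [vOf, h]

/-- The values `γ(p_i)` are bounded uniformly over all of `𝒮`. -/
theorem exists_abs_gammaW_le_s12 {A : Type*} [Fintype A] (σ : A → List A) (γ : A → ℝ) :
    ∃ C : ℝ, ∀ x : ℕ → List A × A × List A, SeqS σ x →
      ∀ i, |gammaW γ (x (i + 1)).1| ≤ C := by
  refine ⟨∑ a : A, ((σ a).map (fun b => |γ b|)).sum, fun x hx i => ?_⟩
  have key : ∀ w : List A, |gammaW γ w| ≤ (w.map (fun b => |γ b|)).sum ∧
      0 ≤ (w.map (fun b => |γ b|)).sum := by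
    intro w
    induction w with
    | nil => simp [gammaW]
    | cons a w ih =>
      simp only [gammaW, List.map_cons, List.sum_cons] at ih ⊢
      exact ⟨(abs_add_le _ _).trans (by linarith [ih.1]), by linarith [ih.2, abs_nonneg (γ a)]⟩
  calc |gammaW γ (x (i + 1)).1| ≤ ((x (i + 1)).1.map (fun b => |γ b|)).sum := (key _).1
    _ ≤ ((σ (x i).2.1).map (fun b => |γ b|)).sum := by
      rw [hx i, List.map_append, List.sum_append]
      linarith [(key ((x (i + 1)).2.1 :: (x (i + 1)).2.2)).2]
    _ ≤ _ := Finset.single_le_sum (f := fun a => ((σ a).map (fun b => |γ b|)).sum)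
      (fun a _ => (key (σ a)).2) (Finset.mem_univ _)

theorem hasSum_zpow_neg_sub_one_mul {θ : ℝ} (hθ : 1 < θ) (C : ℝ) :
    HasSum (fun i : ℕ => θ ^ (-(i : ℤ) - 1) * C) ((1 - θ⁻¹)⁻¹ * θ⁻¹ * C) := by
  have h0 : θ ≠ 0 := by positivity
  have h := ((hasSum_geometric_of_lt_one (by positivity) (inv_lt_one_of_one_lt₀ hθ)).mul_right
    θ⁻¹).mul_right C
  have hfun : (fun i : ℕ => θ ^ (-(i : ℤ) - 1) * C) = fun i : ℕ => θ⁻¹ ^ i * θ⁻¹ * C := by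
    funext i
    rw [zpow_sub_one₀ h0, zpow_neg, zpow_natCast, inv_pow]
  rwa [hfun]

theorem SeqS.summable {A : Type*} [Fintype A] {σ : A → List A} {θ : ℝ} (hθ : 1 < θ)
    (γ : A → ℝ) {x : ℕ → List A × A × List A} (hx : SeqS σ x) :
    Summable (fun i : ℕ => θ ^ (-(i : ℤ) - 1) * gammaW γ (x (i + 1)).1) := by
  obtain ⟨C, hC⟩ := exists_abs_gammaW_le_s12 σ γ
  refine (hasSum_zpow_neg_sub_one_mul hθ C).summable.of_norm_bounded fun i => ?_
  have hpos : 0 < θ ^ (-(i : ℤ) - 1) := zpow_pos (by linarith) _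
  rw [Real.norm_eq_abs, abs_mul, abs_of_pos hpos]
  exact mul_le_mul_of_nonneg_left (hC x hx i) hpos.le

theorem SeqS.vOf_eq {A : Type*} [Fintype A] {σ : A → List A} {θ : ℝ} (hθ : 1 < θ)
    (γ : A → ℝ) {x : ℕ → List A × A × List A} (hx : SeqS σ x) :
    vOf θ γ x = θ⁻¹ * (gammaW γ (x 1).1 + vOf θ γ (fun k => x (k + 1))) := by
  have h0 : θ ≠ 0 := by positivity
  rw [vOf, (hx.summable hθ γ).tsum_eq_zero_add, vOf, mul_add, ← tsum_mul_left]
  congr 1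
  · simp
  · refine tsum_congr fun i => ?_
    rw [← mul_assoc, ← zpow_neg_one, ← zpow_add₀ h0]
    congr 2
    push_cast
    ring

theorem SeqS.vMin_le {A : Type*} [Fintype A] {σ : A → List A} {θ : ℝ} (hθ : 1 < θ)
    (γ : A → ℝ) {x : ℕ → List A × A × List A} (hx : SeqS σ x) :
    vMin σ θ γ (x 0).2.1 ≤ vOf θ γ x := by
  obtain ⟨C, hC⟩ := exists_abs_gammaW_le_s12 σ γ
  have hs := hasSum_zpow_neg_sub_one_mul hθ (-C)
  refine csInf_le ⟨(1 - θ⁻¹)⁻¹ * θ⁻¹ * -C, ?_⟩ ⟨x, hx, rfl, rfl⟩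
  rintro _ ⟨x', hx', -, rfl⟩
  refine hasSum_le (fun i => ?_) hs (hx'.summable hθ γ).hasSum
  exact mul_le_mul_of_nonneg_left (abs_le.1 (hC x' hx' i)).1 (zpow_pos (by linarith) _).le

/-- The shift of a minimizing sequence is minimizing. -/
theorem SeqS.shift_minimizing {A : Type*} [Fintype A] {σ : A → List A} {θ : ℝ} (hθ : 1 < θ)
    (γ : A → ℝ) {z : ℕ → List A × A × List A} (hz : SeqS σ z)
    (hmin : vOf θ γ z = vMin σ θ γ (z 0).2.1) :
    vOf θ γ (fun k => z (k + 1)) = vMin σ θ γ (z 1).2.1 := by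
  refine le_antisymm (le_csInf ⟨_, _, hz.shift 1, rfl, rfl⟩ ?_) ((hz.shift 1).vMin_le hθ γ)
  rintro _ ⟨x, hx, hx0, rfl⟩
  have hw : SeqS σ (spliceW z x 1) := hz.splice hx hx0
  have h := hw.vMin_le hθ γ
  have hx' : vOf θ γ (fun k => spliceW z x 1 (k + 1)) = vOf θ γ x :=
    vOf_congr θ γ fun k => by simp [spliceW]
  have hθ0 : 0 < θ⁻¹ := by positivity
  rw [hw.vOf_eq hθ γ, hx'] at h
  simp only [spliceW, zero_le, le_refl, if_true] at h
  rw [← hmin, hz.vOf_eq hθ γ] at h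
  linarith [le_of_mul_le_mul_left h hθ0]

theorem SeqS.iterate_shift_minimizing {A : Type*} [Fintype A] {σ : A → List A} {θ : ℝ}
    (hθ : 1 < θ) (γ : A → ℝ) {z : ℕ → List A × A × List A} (hz : SeqS σ z)
    (hmin : vOf θ γ z = vMin σ θ γ (z 0).2.1) (m : ℕ) :
    vOf θ γ (fun k => z (k + m)) = vMin σ θ γ (z m).2.1 := by
  induction m with
  | zero => exact hmin
  | succ m ih =>
    have := (hz.shift m).shift_minimizing hθ γ (by simpa using ih)
    simpa only [Nat.add_assoc, Nat.add_comm 1 m] using this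

/-- Lemma 3.10 of the paper: splicing a sequence with the
continuation property with a minimizing sequence `z` for `c_i^y` yields a sequence
in `𝒮` with the continuation property. -/
theorem statement_12 {A : Type*} [Fintype A] [DecidableEq A]
    (σ : A → List A) (hσ : ∀ a, σ a ≠ [])
    (hprim : Primitive σ)
    (hMpos : ∀ a b : A, 0 < (σ a).count b)
    (θ₁ θ₂ : ℝ) (hθ₁alg : IsAlgebraic ℚ θ₁)
    (hθ₂1 : 1 < θ₂) (hθ₂θ₁ : θ₂ < θ₁)
    (hconj : Polynomial.aeval θ₂ (minpoly ℚ θ₁) = 0)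
    (lam : A → ℚ⟮θ₁⟯) (hlampos : ∀ a, (0:ℝ) < (lam a : ℝ))
    (heig1 : ∀ a, ∑ b : A, ((σ a).count b : ℝ) * (lam b : ℝ) = θ₁ * (lam a : ℝ))
    (η : ℚ⟮θ₁⟯ →ₐ[ℚ] ℝ) (hη : η (AdjoinSimple.gen ℚ θ₁) = θ₂)
    (γ : A → ℝ) (hγ : ∀ a, γ a = η (lam a))
    (heig2 : ∀ a, ∑ b : A, ((σ a).count b : ℝ) * γ b = θ₂ * γ a)
    (y : ℕ → List A × A × List A) (hy : SeqS σ y)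
    (hycont : ∀ j : ℕ, vOf θ₂ γ (fun k => y (k + j)) = vMin σ θ₂ γ ((y j).2.1))
    (i : ℕ) (hi : 1 ≤ i)
    (z : ℕ → List A × A × List A) (hz : SeqS σ z)
    (hz0 : (z 0).2.1 = (y i).2.1)
    (hzmin : vOf θ₂ γ z = vMin σ θ₂ γ ((y i).2.1)) :
    SeqS σ (spliceW y z i) ∧
    ∀ j : ℕ, vOf θ₂ γ (fun k => spliceW y z i (k + j))
      = vMin σ θ₂ γ ((spliceW y z i j).2.1) := by
  have hw : SeqS σ (spliceW y z i) := hy.splice hz hz0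
  refine ⟨hw, fun j => ?_⟩
  have hge : ∀ m, vOf θ₂ γ (fun k => spliceW y z i (k + (i + m)))
      = vMin σ θ₂ γ ((spliceW y z i (i + m)).2.1) := by
    intro m
    have hm := hz.iterate_shift_minimizing hθ₂1 γ (by rw [hzmin, hz0]) m
    have hc : ((spliceW y z i (i + m)).2.1) = (z m).2.1 := by
      rcases Nat.eq_zero_or_pos m with rfl | h
      · simp [spliceW, hz0]
      · simp [spliceW, h.ne']
    rw [hc, ← hm]
    refine vOf_congr θ₂ γ fun k => ?_
    simp only [spliceW]
    rw [if_neg (by omega), show k + 1 + (i + m) - i = k + 1 + m by omega]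
  rcases le_total i j with h | h
  · obtain ⟨m, rfl⟩ := Nat.exists_eq_add_of_le h
    exact hge m
  · induction h using Nat.decreasingInduction with
    | self => exact hge 0
    | of_succ j hj ih =>
      have hw' := (hw.shift j).vOf_eq hθ₂1 γ
      have hy' := (hy.shift j).vOf_eq hθ₂1 γ
      simp only [Nat.add_assoc, Nat.add_comm 1 j] at hw' hy'
      rw [hw', ih]
      simp only [spliceW, hj.le, Nat.succ_le_of_lt hj, if_true]
      rw [← hycont (j + 1), ← hy', hycont j]
end
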